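/- Let P and Q be probability distributions on finite sets, neither of which is a uniform distribution (so V(P) > 0 and V(Q) > 0), with H(P)/V(P) = H(Q)/V(Q), and let 0 < ν < 1. Then lim_{n→∞} (L^D_n(P,Q|ν) − (H(P)/H(Q))·n)/√n = √(8 V(P) log(1/ν))/H(Q); in particular R^D_2(P,Q|ν) = √(8 V(P) log(1/ν))/H(Q), the unique b > 0 with exp(−(H(Q)b)²/(8V(P))) = ν. -/

import Mathlib

open MeasureTheory Filter

namespace RNG

variable {α β : Type*}

/-- `P` is a probability distribution on the finite set `α`. -/
def IsProb [Fintype α] (P : α → ℝ) : Prop :=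
  (∀ x, 0 ≤ P x) ∧ ∑ x, P x = 1

open Classical in
/-- Pushforward distribution `W(P)(y) = ∑_{x : W x = y} P x`. -/
noncomputable def push [Fintype α] (W : α → β) (P : α → ℝ) : β → ℝ :=
  fun y => ∑ x, if W x = y then P x else 0

/-- Fidelity (Bhattacharyya coefficient) between distributions on the same finite set. -/
noncomputable def fid [Fintype β] (R S : β → ℝ) : ℝ :=
  ∑ y, Real.sqrt (R y * S y)

/-- Sum of the `l` largest values of `P`, i.e. the `l`-th partial sum of the
decreasing rearrangement of `P` (padded with zeros). -/
noncomputable def topSum [Fintype α] (P : α → ℝ) (l : ℕ) : ℝ :=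
  sSup {s : ℝ | ∃ A : Finset α, A.card ≤ l ∧ s = ∑ x ∈ A, P x}

/-- Majorization `P ≺ P'` (the distributions may live on different finite sets). -/
def Maj [Fintype α] [Fintype β] (P : α → ℝ) (P' : β → ℝ) : Prop :=
  ∀ l : ℕ, topSum P l ≤ topSum P' l

/-- Maximal fidelity under deterministic transformations,
`F^D(P → Q) = max {F(W(P), Q) | W : α → β}`. -/
noncomputable def FD [Fintype α] [Fintype β] (P : α → ℝ) (Q : β → ℝ) : ℝ :=
  sSup {r : ℝ | ∃ W : α → β, r = fid (push W P) Q}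

/-- Maximal fidelity under the majorization condition,
`F^M(P → Q) = max {F(P', Q) | P ≺ P', P'` a distribution on the target set`}`. -/
noncomputable def FM [Fintype α] [Fintype β] (P : α → ℝ) (Q : β → ℝ) : ℝ :=
  sSup {r : ℝ | ∃ P' : β → ℝ, IsProb P' ∧ Maj P P' ∧ r = fid P' Q}

/-- Shannon entropy (natural logarithm). -/
noncomputable def H [Fintype α] (P : α → ℝ) : ℝ := ∑ x, -(P x * Real.log (P x))

/-- Varentropy `V(P)` (natural logarithm). -/
noncomputable def V [Fintype α] (P : α → ℝ) : ℝ :=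
  ∑ x, P x * (-Real.log (P x) - H P) ^ 2

/-- Shannon entropy, base-2 logarithm. -/
noncomputable def H2 [Fintype α] (P : α → ℝ) : ℝ := ∑ x, -(P x * Real.logb 2 (P x))

/-- Varentropy, base-2 logarithm. -/
noncomputable def V2 [Fintype α] (P : α → ℝ) : ℝ :=
  ∑ x, P x * (-Real.logb 2 (P x) - H2 P) ^ 2

/-- The `n`-fold i.i.d. product distribution `P^n`. -/
noncomputable def iid [Fintype α] (P : α → ℝ) (n : ℕ) : (Fin n → α) → ℝ :=
  fun f => ∏ i, P (f i)

/-- The uniform distribution on a two-element set. -/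
noncomputable def U2 : Fin 2 → ℝ := fun _ => 1 / 2

/-- Density of the normal distribution `N(m, v)`. -/
noncomputable def normalPDF (m v t : ℝ) : ℝ :=
  (Real.sqrt (2 * Real.pi * v))⁻¹ * Real.exp (-(t - m) ^ 2 / (2 * v))

/-- Standard normal cumulative distribution function `G`. -/
noncomputable def stdG (x : ℝ) : ℝ := ∫ t in Set.Iic x, normalPDF 0 1 t

/-- Density `N_P` of `N(0, V(P))`. -/
noncomputable def NP [Fintype α] (P : α → ℝ) (x : ℝ) : ℝ := normalPDF 0 (V P) x

/-- Density `N_{P,Q,b}` of `N(H(Q)b, (H(P)/H(Q))·V(Q))`. -/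
noncomputable def NPQ [Fintype α] [Fintype β] (P : α → ℝ) (Q : β → ℝ) (b x : ℝ) : ℝ :=
  normalPDF (H Q * b) (H P / H Q * V Q) x

/-- Cdf `G_P(x) = G(x/√V(P))`. -/
noncomputable def GP [Fintype α] (P : α → ℝ) (x : ℝ) : ℝ := stdG (x / Real.sqrt (V P))

/-- Cdf `G_{P,Q,b}(x) = G(√(H(Q)/(H(P)V(Q)))·(x − H(Q)b))`. -/
noncomputable def GPQ [Fintype α] [Fintype β] (P : α → ℝ) (Q : β → ℝ) (b x : ℝ) : ℝ :=
  stdG (Real.sqrt (H Q / (H P * V Q)) * (x - H Q * b))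

/-- `I_{P,Q,b}(x) = ∫_{−∞}^x √(N_P(t) N_{P,Q,b}(t)) dt`. -/
noncomputable def IPQ [Fintype α] [Fintype β] (P : α → ℝ) (Q : β → ℝ) (b x : ℝ) : ℝ :=
  ∫ t in Set.Iic x, Real.sqrt (NP P t * NPQ P Q b t)

/-- `I_{P,Q,b}(∞) = ∫_ℝ √(N_P(t) N_{P,Q,b}(t)) dt`. -/
noncomputable def IPQinf [Fintype α] [Fintype β] (P : α → ℝ) (Q : β → ℝ) (b : ℝ) : ℝ :=
  ∫ t : ℝ, Real.sqrt (NP P t * NPQ P Q b t)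

/-- `L^D_n(P,Q|ν)`: the maximal `L` with `F^D(P^n → Q^L) ≥ ν`. -/
noncomputable def LD [Fintype α] [Fintype β] (P : α → ℝ) (Q : β → ℝ) (ν : ℝ) (n : ℕ) : ℕ :=
  sSup {L : ℕ | ν ≤ FD (iid P n) (iid Q L)}

/-- The optimal second order rate `R^D_2(P,Q|ν)`. -/
noncomputable def RD2 [Fintype α] [Fintype β] (P : α → ℝ) (Q : β → ℝ) (ν : ℝ) : ℝ :=
  sSup {b : ℝ | ∃ c : ℝ, ν ≤ c ∧
    Tendsto (fun n : ℕ =>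
      FD (iid P n) (iid Q (⌊H P / H Q * n + b * Real.sqrt n⌋₊))) atTop (nhds c)}

lemma push_nonneg [Fintype α] (W : α → β) {P : α → ℝ} (hP : ∀ x, 0 ≤ P x) (y : β) :
    0 ≤ push W P y :=
  Finset.sum_nonneg fun x _ => by split_ifs <;> simp [hP x]

lemma sum_push_mul [Fintype α] [Fintype β] (W : α → β) (P : α → ℝ) (h : β → ℝ) :
    ∑ y, push W P y * h y = ∑ x, P x * h (W x) := by
  classical
  simp only [push, Finset.sum_mul]
  rw [Finset.sum_comm]
  simp

lemma sum_push [Fintype α] [Fintype β] (W : α → β) (P : α → ℝ) :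
    ∑ y, push W P y = ∑ x, P x := by
  simpa using sum_push_mul W P fun _ => 1

lemma le_push [Fintype α] (W : α → β) {P : α → ℝ} (hP : ∀ x, 0 ≤ P x) (x : α) :
    P x ≤ push W P (W x) := by
  classical
  have := Finset.single_le_sum (f := fun x' => if W x' = W x then P x' else 0)
    (fun x' _ => by split_ifs <;> simp [hP x']) (Finset.mem_univ x)
  simpa [push] using this

/-- One-shot converse bound on the fidelity reachable by a deterministic map. -/
lemma fid_push_le [Fintype α] [Fintype β] {P : α → ℝ} {S : β → ℝ} (hP : IsProb P)
    (hS : IsProb S) (W : α → β) {s : ℝ} (hs0 : 0 < s) (hs1 : s < 1) :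
    fid (push W P) S ≤
      √(∑ x, P x ^ (1 - s)) * √((∑ y, S y ^ (1 / (1 - s))) ^ (1 - s)) := by
  set R := push W P with hR
  have hR0 : ∀ y, 0 ≤ R y := push_nonneg W hP.1
  have hCS := Real.sum_sqrt_mul_sqrt_le (f := fun y => R y ^ (1 - s))
    (g := fun y => S y * R y ^ s) Finset.univ (fun y => Real.rpow_nonneg (hR0 y) _)
    (fun y => mul_nonneg (hS.1 y) (Real.rpow_nonneg (hR0 y) _))
  have hfid : fid R S = ∑ y, √(R y ^ (1 - s)) * √(S y * R y ^ s) := by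
    refine Finset.sum_congr rfl fun y _ => ?_
    rw [← Real.sqrt_mul (Real.rpow_nonneg (hR0 y) _)]
    congr 1
    rcases (hR0 y).eq_or_lt with h | h
    · rw [← h, Real.zero_rpow hs0.ne']; simp
    · have : R y ^ (1 - s) * R y ^ s = R y := by
        rw [← Real.rpow_add h]; simp
      linear_combination (-S y) * this
  have h1 : ∑ y, R y ^ (1 - s) ≤ ∑ x, P x ^ (1 - s) := by
    have : ∀ y, R y ^ (1 - s) = R y * R y ^ (-s) := by
      intro y
      rcases (hR0 y).eq_or_lt with h | h
      · rw [← h, Real.zero_rpow (by linarith)]; simp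
      · rw [← Real.rpow_one_add' h.le (by linarith)]; rfl
    simp_rw [this]
    rw [hR, sum_push_mul W P fun y => push W P y ^ (-s)]
    refine Finset.sum_le_sum fun x _ => ?_
    rcases (hP.1 x).eq_or_lt with h | h
    · rw [← h]; simpa using Real.rpow_nonneg le_rfl _
    · calc P x * push W P (W x) ^ (-s) ≤ P x * P x ^ (-s) := by
            refine mul_le_mul_of_nonneg_left ?_ h.le
            exact Real.rpow_le_rpow_of_nonpos h (le_push W hP.1 x) (by linarith)
        _ = P x ^ (1 - s) := by rw [← Real.rpow_one_add' h.le (by linarith)]; rfl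
  have h2 : ∑ y, S y * R y ^ s ≤ (∑ y, S y ^ (1 / (1 - s))) ^ (1 - s) := by
    have hpq : (1 / (1 - s)).HolderConjugate (1 / s) := by
      rw [Real.holderConjugate_iff]
      refine ⟨by rw [lt_div_iff₀] <;> linarith, by simp⟩
    have := Real.inner_le_Lp_mul_Lq_of_nonneg Finset.univ hpq (f := S)
      (g := fun y => R y ^ s) (fun y _ => hS.1 y) (fun y _ => Real.rpow_nonneg (hR0 y) _)
    have e : ∀ y, (R y ^ s) ^ (1 / s) = R y := fun y => by
      rw [← Real.rpow_mul (hR0 y), mul_one_div_cancel hs0.ne', Real.rpow_one]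
    simp_rw [e] at this
    rw [hR, sum_push, hP.2] at this
    simpa using this
  rw [hfid]
  refine hCS.trans (mul_le_mul (Real.sqrt_le_sqrt h1) (Real.sqrt_le_sqrt h2)
    (Real.sqrt_nonneg _) (Real.sqrt_nonneg _))

lemma isProb_iid [Fintype α] {P : α → ℝ} (hP : IsProb P) (n : ℕ) : IsProb (iid P n) := by
  refine ⟨fun f => Finset.prod_nonneg fun i _ => hP.1 _, ?_⟩
  simp only [iid]
  rw [← Fintype.sum_pow, hP.2, one_pow]

lemma sum_iid_rpow [Fintype α] {P : α → ℝ} (hP : IsProb P) (n : ℕ) (r : ℝ) :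
    ∑ f, iid P n f ^ r = (∑ x, P x ^ r) ^ n := by
  rw [Fintype.sum_pow]
  exact Finset.sum_congr rfl fun f _ => (Real.finsetProd_rpow _ _ (fun i _ => hP.1 _) r).symm

lemma sum_mul_centered [Fintype α] {P : α → ℝ} (hP : IsProb P) :
    ∑ x, P x * (-Real.log (P x) - H P) = 0 := by
  simp only [mul_sub, Finset.sum_sub_distrib, ← Finset.sum_mul, hP.2, one_mul]
  simp [H]

/-- Second order upper bound on the Rényi-type power sum near exponent `1`. -/
lemma exists_sum_rpow_le [Fintype α] {P : α → ℝ} (hP : IsProb P) :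
    ∃ C : ℝ, 0 ≤ C ∧ ∃ s₀ : ℝ, 0 < s₀ ∧ s₀ ≤ 1 / 2 ∧ ∀ s : ℝ, |s| ≤ s₀ →
      ∑ x, P x ^ (1 - s) ≤ Real.exp (s * H P + s ^ 2 * V P / 2 + C * |s| ^ 3) := by
  set g : α → ℝ := fun x => -Real.log (P x) - H P with hg
  obtain ⟨B, hB1, hB⟩ : ∃ B : ℝ, 2 ≤ B ∧ ∀ x, |g x| ≤ B := by
    refine ⟨2 + ∑ x, |g x|, ?_, fun x => ?_⟩
    · have := Finset.sum_nonneg fun x (_ : x ∈ Finset.univ) => abs_nonneg (g x)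
      linarith
    · have := Finset.single_le_sum (fun x _ => abs_nonneg (g x)) (Finset.mem_univ x)
      linarith
  refine ⟨B ^ 3, by positivity, 1 / B, by positivity,
    one_div_le_one_div_of_le (by norm_num) hB1, fun s hs => ?_⟩
  have hs2 : |s| ≤ 1 / 2 := hs.trans (one_div_le_one_div_of_le (by norm_num) hB1)
  have hterm : ∀ x, P x ^ (1 - s) ≤
      Real.exp (s * H P) * (P x * (1 + s * g x + s ^ 2 * g x ^ 2 / 2 + B ^ 3 * |s| ^ 3)) := by
    intro x
    rcases (hP.1 x).eq_or_lt with h | h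
    · rw [← h, Real.zero_rpow (by linarith [le_abs_self s])]; simp
    · have e : P x ^ (1 - s) = Real.exp (s * H P) * (P x * Real.exp (s * g x)) := by
        rw [Real.rpow_def_of_pos h]
        nth_rewrite 2 [← Real.exp_log h]
        rw [← Real.exp_add, ← Real.exp_add]
        congr 1
        simp only [hg]; ring
      rw [e]
      refine mul_le_mul_of_nonneg_left (mul_le_mul_of_nonneg_left ?_ h.le) (Real.exp_pos _).le
      have hsg : |s * g x| ≤ |s| * B := by
        rw [abs_mul]; exact mul_le_mul_of_nonneg_left (hB x) (abs_nonneg _)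
      have hsg1 : |s * g x| ≤ 1 := by
        refine hsg.trans ?_
        rw [le_div_iff₀ (by linarith)] at hs
        exact hs
      have := (abs_le.1 (Real.exp_bound hsg1 (n := 3) (by norm_num))).2
      have h3 : |s * g x| ^ 3 ≤ (|s| * B) ^ 3 := pow_le_pow_left₀ (abs_nonneg _) hsg 3
      norm_num [Finset.sum_range_succ, Nat.factorial] at this
      have h4 : 0 ≤ (|s| * B) ^ 3 := by positivity
      rw [← abs_mul] at this
      nlinarith [this, h3, h4]
  refine (Finset.sum_le_sum fun x _ => hterm x).trans ?_
  rw [← Finset.mul_sum]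
  have e : ∑ x, P x * (1 + s * g x + s ^ 2 * g x ^ 2 / 2 + B ^ 3 * |s| ^ 3) =
      1 + (s ^ 2 * V P / 2 + B ^ 3 * |s| ^ 3) := by
    have h1 : ∑ x, P x * g x = 0 := sum_mul_centered hP
    have h2 : ∑ x, P x * g x ^ 2 = V P := rfl
    calc _ = ∑ x, (P x * (1 + B ^ 3 * |s| ^ 3) + s * (P x * g x)
            + s ^ 2 / 2 * (P x * g x ^ 2)) := Finset.sum_congr rfl fun x _ => by ring
      _ = _ := by
        rw [Finset.sum_add_distrib, Finset.sum_add_distrib, ← Finset.sum_mul,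
          ← Finset.mul_sum, ← Finset.mul_sum, h1, h2, hP.2]
        ring
  rw [e, add_assoc, Real.exp_add]
  refine mul_le_mul_of_nonneg_left ?_ (Real.exp_pos _).le
  linarith [Real.add_one_le_exp (s ^ 2 * V P / 2 + B ^ 3 * |s| ^ 3)]

lemma neg_mul_log_nonneg [Fintype α] {P : α → ℝ} (hP : IsProb P) (x : α) :
    0 ≤ -(P x * Real.log (P x)) := by
  have hle : P x ≤ 1 := hP.2 ▸ Finset.single_le_sum (fun x _ => hP.1 x) (Finset.mem_univ x)
  linarith [mul_nonpos_of_nonneg_of_nonpos (hP.1 x) (Real.log_nonpos (hP.1 x) hle)]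

lemma H_pos [Fintype α] {P : α → ℝ} (hP : IsProb P) (hV : 0 < V P) : 0 < H P := by
  refine (Finset.sum_nonneg fun x _ => neg_mul_log_nonneg hP x).lt_of_ne' fun h => hV.ne' ?_
  have h0 := (Finset.sum_eq_zero_iff_of_nonneg fun x _ => neg_mul_log_nonneg hP x).1 h
  refine Finset.sum_eq_zero fun x hx => ?_
  have hx0 := h0 x hx
  have hH : H P = 0 := h
  rw [hH]
  linear_combination Real.log (P x) * (-1) * hx0

lemma sum_rpow_le_one [Fintype α] {P : α → ℝ} (hP : IsProb P) {r : ℝ} (hr : 1 ≤ r) :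
    ∑ x, P x ^ r ≤ 1 := by
  rw [← hP.2]
  refine Finset.sum_le_sum fun x _ => ?_
  have hle : P x ≤ 1 := hP.2 ▸ Finset.single_le_sum (fun x _ => hP.1 x) (Finset.mem_univ x)
  simpa using Real.rpow_le_rpow_of_exponent_ge_of_imp (hP.1 x) hle hr (fun _ h => by linarith)

/-- A converse bound for all target block lengths at least `L`, in exponential form. -/
lemma exists_FD_le_exp [Fintype α] [Fintype β] {P : α → ℝ} {Q : β → ℝ} (hP : IsProb P)
    (hQ : IsProb Q) :
    ∃ C D e₀ : ℝ, 0 < e₀ ∧ ∀ e : ℝ, 0 < e → e ≤ e₀ → ∀ n L L' : ℕ, L ≤ L' →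
      FD (iid P n) (iid Q L') ≤ Real.exp ((1 / 2) * (
        n * (e / (1 + e)) * (H P + (e / (1 + e)) * V P / 2 + C * (e / (1 + e)) ^ 2) +
        L * (e / (1 + e)) * (-H Q + e * V Q / 2 + D * e ^ 2))) := by
  obtain ⟨C, hC, s₀, hs₀, -, hPs⟩ := exists_sum_rpow_le hP
  obtain ⟨D, hD, t₀, ht₀, -, hQt⟩ := exists_sum_rpow_le hQ
  refine ⟨C, D, min s₀ t₀, lt_min hs₀ ht₀, fun e he hee n L L' hLL => ?_⟩
  set s := e / (1 + e) with hs
  have hs0 : 0 < s := by positivity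
  have hse : s ≤ e := div_le_self he.le (by linarith)
  have hs1 : s < 1 := by rw [hs, div_lt_one (by positivity)]; linarith
  have h1s : 1 - s = 1 / (1 + e) := by rw [hs]; field_simp; ring
  have hinv : 1 / (1 - s) = 1 - (-e) := by rw [h1s]; simp
  have h1 := hPs s (by rw [abs_of_pos hs0]; exact hse.trans (hee.trans (min_le_left _ _)))
  have h2 := hQt (-e) (by rw [abs_neg, abs_of_pos he]; exact hee.trans (min_le_right _ _))
  rw [abs_of_pos hs0] at h1
  rw [abs_neg, abs_of_pos he] at h2
  have hb0 : 0 ≤ ∑ y, Q y ^ (1 - -e) :=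
    Finset.sum_nonneg fun y _ => Real.rpow_nonneg (hQ.1 y) _
  have ha0 : 0 ≤ ∑ x, P x ^ (1 - s) :=
    Finset.sum_nonneg fun y _ => Real.rpow_nonneg (hP.1 y) _
  refine Real.sSup_le ?_ (Real.exp_pos _).le
  rintro _ ⟨W, rfl⟩
  refine (fid_push_le (isProb_iid hP n) (isProb_iid hQ L') W hs0 hs1).trans ?_
  rw [sum_iid_rpow hP, sum_iid_rpow hQ, hinv]
  have k1 : (∑ x, P x ^ (1 - s)) ^ n ≤ Real.exp (n * s * (H P + s * V P / 2 + C * s ^ 2)) := by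
    refine (pow_le_pow_left₀ ha0 h1 n).trans (le_of_eq ?_)
    rw [← Real.exp_nat_mul]; congr 1; ring
  have k2 : ((∑ y, Q y ^ (1 - -e)) ^ L') ^ (1 - s) ≤
      Real.exp (L * s * (-H Q + e * V Q / 2 + D * e ^ 2)) := by
    have : (∑ y, Q y ^ (1 - -e)) ^ L' ≤
        Real.exp (-e * H Q + (-e) ^ 2 * V Q / 2 + D * e ^ 3) ^ L :=
      (pow_le_pow_of_le_one hb0 (sum_rpow_le_one hQ (by linarith)) hLL).trans
        (pow_le_pow_left₀ hb0 h2 L)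
    refine (Real.rpow_le_rpow (pow_nonneg hb0 _) this (by linarith)).trans (le_of_eq ?_)
    rw [← Real.exp_nat_mul, ← Real.exp_mul, h1s]; congr 1
    rw [hs]; field_simp
  calc _ ≤ √(Real.exp (n * s * (H P + s * V P / 2 + C * s ^ 2))) *
        √(Real.exp (L * s * (-H Q + e * V Q / 2 + D * e ^ 2))) :=
        mul_le_mul (Real.sqrt_le_sqrt k1) (Real.sqrt_le_sqrt k2) (Real.sqrt_nonneg _)
          (Real.sqrt_nonneg _)
    _ = _ := by
      rw [← Real.exp_half, ← Real.exp_half, ← Real.exp_add]; congr 1; ring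

lemma tendsto_sqrt_natCast : Tendsto (fun n : ℕ => √(n : ℝ)) atTop atTop :=
  Real.tendsto_sqrt_atTop.comp tendsto_natCast_atTop_atTop

lemma tendsto_div_of_second_order {L : ℕ → ℕ} {r b : ℝ}
    (hL : Tendsto (fun n : ℕ => ((L n : ℝ) - r * n) / √n) atTop (nhds b)) :
    Tendsto (fun n : ℕ => (L n : ℝ) / n) atTop (nhds r) := by
  have h := (hL.mul (tendsto_inv_atTop_zero.comp tendsto_sqrt_natCast)).const_add r
  rw [mul_zero, add_zero] at h
  refine h.congr' ?_
  filter_upwards [eventually_gt_atTop 0] with n hn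
  have hn' : (0 : ℝ) < n := by exact_mod_cast hn
  have h2 := Real.sq_sqrt hn'.le
  have h3 := Real.sqrt_pos.2 hn'
  simp only [Function.comp]
  field_simp
  rw [h2]; ring

lemma eventually_FD_lt [Fintype α] [Fintype β] {P : α → ℝ} {Q : β → ℝ} (hP : IsProb P)
    (hQ : IsProb Q) (hVP : 0 < V P) (hVQ : 0 < V Q) (hratio : H P / V P = H Q / V Q)
    {L : ℕ → ℕ} {b : ℝ} (hb : 0 < b)
    (hL : Tendsto (fun n : ℕ => ((L n : ℝ) - H P / H Q * n) / √n) atTop (nhds b))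
    {c : ℝ} (hc : Real.exp (-(H Q * b) ^ 2 / (8 * V P)) < c) :
    ∀ᶠ n : ℕ in atTop, ∀ L' : ℕ, L n ≤ L' → FD (iid P n) (iid Q L') < c := by
  obtain ⟨C, D, e₀, he₀, hFD⟩ := exists_FD_le_exp hP hQ
  have hHQ := H_pos hQ hVQ
  set θ := b * H Q / (2 * V P) with hθ
  have hθ0 : 0 < θ := by positivity
  set e : ℕ → ℝ := fun n => θ / √n with he
  have he_lim : Tendsto e atTop (nhds 0) := tendsto_sqrt_natCast.const_div_atTop θ
  set s : ℕ → ℝ := fun n => e n / (1 + e n) with hs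
  have h1e : Tendsto (fun n => 1 + e n) atTop (nhds 1) := by simpa using he_lim.const_add 1
  have hs_lim : Tendsto s atTop (nhds 0) := by
    rw [← zero_div (1 : ℝ)]; exact he_lim.div h1e one_ne_zero
  have hpos : ∀ᶠ n : ℕ in atTop, (0 : ℝ) < n := by
    filter_upwards [eventually_gt_atTop 0] with n hn using by exact_mod_cast hn
  have hsn : Tendsto (fun n : ℕ => √(n : ℝ) * s n) atTop (nhds θ) := by
    have : Tendsto (fun n => θ / (1 + e n)) atTop (nhds θ) := by
      have := (tendsto_const_nhds (x := θ)).div h1e one_ne_zero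
      rwa [div_one] at this
    refine this.congr' ?_
    filter_upwards [hpos] with n hn
    have := Real.sqrt_pos.2 hn
    simp only [hs, he]; field_simp
  have hLn : Tendsto (fun n : ℕ => (L n : ℝ) / √n * e n) atTop (nhds (θ * (H P / H Q))) := by
    refine ((tendsto_div_of_second_order hL).const_mul θ).congr' ?_
    filter_upwards [hpos] with n hn
    have := Real.sqrt_pos.2 hn
    change θ * ((L n : ℝ) / n) = (L n : ℝ) / √n * (θ / √n)
    rw [div_mul_div_comm (L n : ℝ), Real.mul_self_sqrt hn.le]; ring
  have hmain : Tendsto (fun n : ℕ => (√(n : ℝ) * s n) *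
      (-(((L n : ℝ) - H P / H Q * n) / √n) * H Q + (√(n : ℝ) * s n) * (V P / 2) +
        C * ((√(n : ℝ) * s n) * s n) + (L n : ℝ) / √n * e n * (V Q / 2 + D * e n))) atTop
      (nhds (θ * (-b * H Q + θ * (V P / 2) + C * (θ * 0) +
        θ * (H P / H Q) * (V Q / 2 + D * 0)))) :=
    hsn.mul ((((hL.neg.mul_const _).add (hsn.mul_const _)).add
      ((hsn.mul hs_lim).const_mul C)).add (hLn.mul ((he_lim.const_mul D).const_add _)))
  have hval : θ * (-b * H Q + θ * (V P / 2) + C * (θ * 0) +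
        θ * (H P / H Q) * (V Q / 2 + D * 0)) = -(H Q * b) ^ 2 / (4 * V P) := by
    have : H P / H Q * V Q = V P := by
      rw [div_eq_div_iff hVP.ne' hVQ.ne'] at hratio
      field_simp; linarith
    calc _ = θ * (-b * H Q + θ * (V P / 2) + θ * (H P / H Q * V Q) / 2) := by ring
      _ = _ := by rw [this, hθ]; field_simp; ring
  rw [hval] at hmain
  have hexp := (Real.continuous_exp.tendsto _).comp (hmain.const_mul (1 / 2))
  have hval2 : 1 / 2 * (-(H Q * b) ^ 2 / (4 * V P)) = -(H Q * b) ^ 2 / (8 * V P) := by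
    field_simp; norm_num
  rw [hval2] at hexp
  filter_upwards [hexp.eventually_lt_const hc, hpos, he_lim.eventually_le_const he₀]
    with n hn hn0 hne L' hL'
  have hsq := Real.sqrt_pos.2 hn0
  refine (hFD (e n) (by simp only [he]; positivity) hne n (L n) L' hL').trans_lt
    ((le_of_eq ?_).trans_lt hn)
  have h2 : (n : ℝ) = √n ^ 2 := (Real.sq_sqrt hn0.le).symm
  simp only [Function.comp]
  congr 2
  change n * s n * (H P + s n * V P / 2 + C * s n ^ 2) +
    L n * s n * (-H Q + e n * V Q / 2 + D * e n ^ 2) = _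
  generalize √(n : ℝ) = q at *
  rw [h2]
  field_simp
  ring

/-- Greedy allocation: a finite collection of small masses can be grouped so that prescribed
targets are met up to the size of one mass. -/
lemma exists_greedy [Nonempty β] {P : α → ℝ} (hP : ∀ x, 0 ≤ P x) {t : β → ℝ} {c : ℝ}
    (B : Finset β) :
    ∀ A : Finset α, (∀ x ∈ A, P x ≤ c) → 0 ≤ c → (∀ y ∈ B, 0 ≤ t y) →
      ∑ y ∈ B, t y ≤ ∑ x ∈ A, P x →
      ∃ W : α → β, ∀ y ∈ B, ∀ T : Finset α, (∀ x ∈ A, W x = y → x ∈ T) →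
        t y - c ≤ ∑ x ∈ T, P x := by
  classical
  induction B using Finset.induction_on with
  | empty => exact fun A _ _ _ _ => ⟨fun _ => Classical.arbitrary β, by simp⟩
  | insert y B hy ih =>
    intro A hA hc ht hsum
    rw [Finset.sum_insert hy] at hsum
    have htB : ∀ z ∈ B, 0 ≤ t z := fun z hz => ht z (Finset.mem_insert_of_mem hz)
    obtain ⟨A₀, hA₀, hmax⟩ := Finset.exists_max_image
      (A.powerset.filter fun T => ∑ x ∈ T, P x ≤ t y) Finset.card
      ⟨∅, by simp [ht y (Finset.mem_insert_self _ _)]⟩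
    rw [Finset.mem_filter, Finset.mem_powerset] at hA₀
    have hlow : t y - c ≤ ∑ x ∈ A₀, P x := by
      by_cases hAA : A ⊆ A₀
      · have := Finset.sum_le_sum_of_subset_of_nonneg hAA fun x _ _ => hP x
        linarith [Finset.sum_nonneg htB]
      · obtain ⟨x, hxA, hx⟩ := Finset.not_subset.1 hAA
        by_contra! hlt
        have hmem : insert x A₀ ∈ A.powerset.filter fun T => ∑ x ∈ T, P x ≤ t y := by
          rw [Finset.mem_filter, Finset.mem_powerset, Finset.sum_insert hx]
          exact ⟨Finset.insert_subset hxA hA₀.1, by linarith [hA x hxA]⟩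
        have := hmax _ hmem
        rw [Finset.card_insert_of_notMem hx] at this
        omega
    obtain ⟨W, hW⟩ := ih (A \ A₀) (fun x hx => hA x (Finset.mem_sdiff.1 hx).1) hc htB (by
      have := Finset.sum_sdiff (f := P) hA₀.1
      linarith [hA₀.2])
    refine ⟨fun x => if x ∈ A₀ then y else W x, fun z hz T hT => ?_⟩
    rcases Finset.mem_insert.1 hz with rfl | hzB
    · refine hlow.trans (Finset.sum_le_sum_of_subset_of_nonneg (fun x hx => ?_) fun x _ _ => hP x)
      exact hT x (hA₀.1 hx) (by simp [hx])
    · refine hW z hzB T fun x hx hxz => ?_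
      rw [Finset.mem_sdiff] at hx
      exact hT x hx.1 (by simp [hx.2, hxz])

lemma fid_le_FD [Fintype α] [Fintype β] (P : α → ℝ) (S : β → ℝ) (W : α → β) :
    fid (push W P) S ≤ FD P S := by
  classical
  refine le_csSup (Set.Finite.bddAbove ?_) ⟨W, rfl⟩
  refine (Set.finite_range fun W : α → β => fid (push W P) S).subset ?_
  rintro _ ⟨W, rfl⟩
  exact ⟨W, rfl⟩

/-- One-shot achievability bound: bins of the source are spread over matching bins of the target
whose points are heavier. -/
lemma sum_sqrt_le_FD [Fintype α] [Fintype β] {ι : Type*} (I : Finset ι) {P : α → ℝ} {S : β → ℝ}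
    (hP : IsProb P) (hS : IsProb S) (A : ι → Finset α) (B : ι → Finset β)
    (hA : (I : Set ι).PairwiseDisjoint A) (hB : (I : Set ι).PairwiseDisjoint B)
    {c d : ι → ℝ} (hc : ∀ i ∈ I, 0 ≤ c i) (hd : ∀ i ∈ I, 0 < d i)
    (hAc : ∀ i ∈ I, ∀ x ∈ A i, P x ≤ c i) (hBd : ∀ i ∈ I, ∀ y ∈ B i, d i ≤ S y) :
    ∑ i ∈ I, (√((∑ x ∈ A i, P x) * ∑ y ∈ B i, S y) - √(c i / d i)) ≤ FD P S := by
  classical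
  have : Nonempty β := by
    by_contra h
    rw [not_nonempty_iff] at h
    simpa using hS.2
  set p : ι → ℝ := fun i => ∑ x ∈ A i, P x with hp
  set q : ι → ℝ := fun i => ∑ y ∈ B i, S y with hq
  have hp0 : ∀ i, 0 ≤ p i := fun i => Finset.sum_nonneg fun x _ => hP.1 x
  have hq0 : ∀ i, 0 ≤ q i := fun i => Finset.sum_nonneg fun x _ => hS.1 x
  have hgreedy : ∀ i : ι, ∃ W : α → β, i ∈ I → ∀ y ∈ B i, ∀ T : Finset α,
      (∀ x ∈ A i, W x = y → x ∈ T) → S y * (p i / q i) - c i ≤ ∑ x ∈ T, P x := by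
    intro i
    by_cases hi : i ∈ I
    · obtain ⟨W, hW⟩ := exists_greedy hP.1 (t := fun y => S y * (p i / q i)) (B i) (A i)
        (hAc i hi) (hc i hi) (fun y _ => mul_nonneg (hS.1 y) (div_nonneg (hp0 i) (hq0 i))) (by
          rw [← Finset.sum_mul]
          change q i * (p i / q i) ≤ p i
          rcases eq_or_ne (q i) 0 with h | h
          · rw [h]; simpa using hp0 i
          · rw [mul_div_cancel₀ _ h])
      exact ⟨W, fun _ => hW⟩
    · exact ⟨fun _ => Classical.arbitrary β, fun h => absurd h hi⟩
  choose Wi hWi using hgreedy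
  let W : α → β := fun x => if h : ∃ i ∈ I, x ∈ A i then Wi h.choose x else Classical.arbitrary β
  have hW : ∀ i ∈ I, ∀ x ∈ A i, W x = Wi i x := by
    intro i hi x hx
    have h : ∃ i ∈ I, x ∈ A i := ⟨i, hi, hx⟩
    have he : h.choose = i := by
      by_contra hne
      exact Finset.disjoint_left.1 (hA h.choose_spec.1 hi hne) h.choose_spec.2 hx
    simp only [W, dif_pos h, he]
  have hpush : ∀ i ∈ I, ∀ y ∈ B i, S y * (p i / q i) - c i ≤ push W P y := by
    intro i hi y hy
    have := hWi i hi y hy (Finset.univ.filter fun x => W x = y) (fun x hx hxy => by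
      simp [hW i hi x hx, hxy])
    rw [Finset.sum_filter] at this
    simpa [push] using this
  refine le_trans ?_ (fid_le_FD P S W)
  have hbin : ∀ i ∈ I, √(p i * q i) - √(c i / d i) ≤ ∑ y ∈ B i, √(push W P y * S y) := by
    intro i hi
    rcases (hq0 i).eq_or_lt with h | h
    · rw [← h, mul_zero, Real.sqrt_zero]
      have := Finset.sum_nonneg fun y (_ : y ∈ B i) => Real.sqrt_nonneg (push W P y * S y)
      linarith [Real.sqrt_nonneg (c i / d i)]
    have hpt : ∀ y ∈ B i, S y * √(p i / q i) - S y * √(c i / d i) ≤ √(push W P y * S y) := by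
      intro y hy
      have hdS := hBd i hi y hy
      have hSy := (hd i hi).trans_le hdS
      have h1 := hpush i hi y hy
      have h2 : c i ≤ c i / d i * S y := by
        rw [div_mul_eq_mul_div, le_div_iff₀ (hd i hi)]
        exact mul_le_mul_of_nonneg_left hdS (hc i hi)
      have hcd : 0 ≤ c i / d i := div_nonneg (hc i hi) (hd i hi).le
      have hpq : 0 ≤ p i / q i := div_nonneg (hp0 i) (hq0 i)
      have h3 : S y ^ 2 * (p i / q i - c i / d i) ≤ push W P y * S y := by nlinarith
      calc S y * √(p i / q i) - S y * √(c i / d i)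
          ≤ S y * √(p i / q i - c i / d i) := by
            rw [← mul_sub]
            refine mul_le_mul_of_nonneg_left ?_ hSy.le
            rw [sub_le_iff_le_add]
            have hu : p i / q i - c i / d i ≤ √(p i / q i - c i / d i) ^ 2 :=
              Real.sqrt_le_left (Real.sqrt_nonneg _) |>.1 le_rfl
            have hu0 := Real.sqrt_nonneg (p i / q i - c i / d i)
            have hv0 := Real.sqrt_nonneg (c i / d i)
            refine Real.sqrt_le_iff.2 ⟨by positivity, ?_⟩
            nlinarith [Real.sq_sqrt hcd, mul_nonneg hu0 hv0]
        _ = √(S y ^ 2 * (p i / q i - c i / d i)) := by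
            rw [Real.sqrt_mul (sq_nonneg _), Real.sqrt_sq hSy.le]
        _ ≤ _ := Real.sqrt_le_sqrt h3
    have hsum := Finset.sum_le_sum hpt
    rw [Finset.sum_sub_distrib, ← Finset.sum_mul, ← Finset.sum_mul] at hsum
    change q i * √(p i / q i) - q i * √(c i / d i) ≤ _ at hsum
    have hq1 : q i ≤ 1 := by
      rw [← hS.2]
      exact Finset.sum_le_sum_of_subset_of_nonneg (Finset.subset_univ _) fun y _ _ => hS.1 y
    have he : q i * √(p i / q i) = √(p i * q i) := by
      rw [← Real.sqrt_sq h.le, ← Real.sqrt_mul (sq_nonneg _), Real.sqrt_sq h.le]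
      congr 1; field_simp
    have := mul_le_of_le_one_left (Real.sqrt_nonneg (c i / d i)) hq1
    linarith
  calc _ ≤ ∑ i ∈ I, ∑ y ∈ B i, √(push W P y * S y) := Finset.sum_le_sum hbin
    _ = ∑ y ∈ I.biUnion B, √(push W P y * S y) := (Finset.sum_biUnion hB).symm
    _ ≤ _ := Finset.sum_le_sum_of_subset_of_nonneg (Finset.subset_univ _)
        fun y _ _ => Real.sqrt_nonneg _

/-- The law on `ℝ` of the statistic `T` under the finite distribution `P`. -/
noncomputable def law [Fintype α] (P T : α → ℝ) : Measure ℝ :=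
  ∑ x, ENNReal.ofReal (P x) • Measure.dirac (T x)

lemma isProbabilityMeasure_law [Fintype α] {P : α → ℝ} (hP : IsProb P) (T : α → ℝ) :
    IsProbabilityMeasure (law P T) := by
  refine ⟨?_⟩
  simp only [law, Measure.coe_finsetSum, Finset.sum_apply, Measure.smul_apply, measure_univ,
    smul_eq_mul, mul_one]
  rw [← ENNReal.ofReal_sum_of_nonneg fun x _ => hP.1 x, hP.2, ENNReal.ofReal_one]

lemma integral_law [Fintype α] {P : α → ℝ} (hP : IsProb P) (T : α → ℝ) {E : Type*}
    [NormedAddCommGroup E] [NormedSpace ℝ E] [CompleteSpace E] (h : ℝ → E) :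
    ∫ t, h t ∂(law P T) = ∑ x, P x • h (T x) := by
  rw [law, integral_finsetSum_measure fun x _ =>
    (integrable_dirac enorm_lt_top).smul_measure ENNReal.ofReal_ne_top]
  refine Finset.sum_congr rfl fun x _ => ?_
  rw [integral_smul_measure, integral_dirac, ENNReal.toReal_ofReal (hP.1 x)]

open Classical in
lemma law_real_apply [Fintype α] {P : α → ℝ} (hP : IsProb P) (T : α → ℝ) {s : Set ℝ}
    (hs : MeasurableSet s) :
    (law P T).real s = ∑ x with T x ∈ s, P x := by
  have := isProbabilityMeasure_law hP T
  rw [← integral_indicator_one hs, integral_law hP, Finset.sum_filter]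
  refine Finset.sum_congr rfl fun x _ => ?_
  by_cases h : T x ∈ s <;> simp [h]

/-- Standardized surprisal of a word of length `n`. -/
noncomputable def zscore [Fintype α] (P : α → ℝ) (n : ℕ) (f : Fin n → α) : ℝ :=
  (√n)⁻¹ * ∑ i, (-Real.log (P (f i)) - H P) / √(V P)

lemma charFun_law_zscore [Fintype α] {P : α → ℝ} (hP : IsProb P) (n : ℕ) (t : ℝ) :
    charFun (law (iid P n) (zscore P n)) t =
      charFun (law P fun x => (-Real.log (P x) - H P) / √(V P)) ((√n)⁻¹ * t) ^ n := by
  rw [charFun_apply_real, charFun_apply_real, integral_law (isProb_iid hP n), integral_law hP,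
    Fintype.sum_pow]
  refine Finset.sum_congr rfl fun f _ => ?_
  simp only [Complex.real_smul, Finset.prod_mul_distrib]
  rw [← Complex.exp_sum, iid, Complex.ofReal_prod]
  congr 2
  simp only [zscore]
  push_cast
  rw [Finset.mul_sum, Finset.mul_sum, Finset.sum_mul]
  exact Finset.sum_congr rfl fun i _ => by ring

lemma tendsto_law_zscore [Fintype α] {P : α → ℝ} (hP : IsProb P) (hV : 0 < V P) (a b : ℝ) :
    Tendsto (fun n => (law (iid P n) (zscore P n)).real (Set.Ico a b)) atTop
      (nhds ((ProbabilityTheory.gaussianReal 0 1).real (Set.Ico a b))) := by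
  set g : α → ℝ := fun x => (-Real.log (P x) - H P) / √(V P) with hg
  have hlaw := isProbabilityMeasure_law hP g
  have hmean : ∫ x, id x ∂(law P g) = 0 := by
    rw [integral_law hP]
    simp only [hg, id, smul_eq_mul, ← mul_div_assoc]
    rw [← Finset.sum_div, sum_mul_centered hP, zero_div]
  have hvar : ∫ x, (id ^ 2 : ℝ → ℝ) x ∂(law P g) = 1 := by
    rw [integral_law hP]
    simp only [hg, id, smul_eq_mul, Pi.pow_apply, div_pow, Real.sq_sqrt hV.le, ← mul_div_assoc]
    rw [← Finset.sum_div]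
    exact div_self hV.ne'
  let μ : ℕ → ProbabilityMeasure ℝ := fun n =>
    ⟨law (iid P n) (zscore P n), isProbabilityMeasure_law (isProb_iid hP n) _⟩
  let γ : ProbabilityMeasure ℝ := ⟨ProbabilityTheory.gaussianReal 0 1, inferInstance⟩
  have hμ : Tendsto μ atTop (nhds γ) := by
    rw [ProbabilityMeasure.tendsto_iff_tendsto_charFun]
    intro t
    have := ProbabilityTheory.tendsto_charFun_inv_sqrt_mul_pow (P := law P g) (X := id)
      aemeasurable_id hmean hvar t
    rw [Measure.map_id] at this
    simp only [μ, γ, ProbabilityMeasure.coe_mk, charFun_law_zscore hP,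
      ProbabilityTheory.charFun_gaussianReal]
    simpa [neg_div] using this
  have hfr : (γ : Measure ℝ) (frontier (Set.Ico a b)) = 0 := by
    have : NullSingletonClass (ProbabilityTheory.gaussianReal 0 1) :=
      ProbabilityTheory.nullSingletonClass_gaussianReal one_ne_zero
    rcases lt_or_ge a b with h | h
    · rw [frontier_Ico h]
      exact (Set.toFinite {a, b}).measure_zero (ProbabilityTheory.gaussianReal 0 1)
    · simp [Set.Ico_eq_empty_of_le h]
  have := ProbabilityMeasure.tendsto_measure_of_null_frontier_of_tendsto' hμ hfr
  exact (ENNReal.tendsto_toReal (measure_ne_top _ _)).comp this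

lemma integral_mul_le_sqrt_mul_sqrt {μ : Measure ℝ} {f g : ℝ → ℝ} (hf0 : ∀ x, 0 ≤ f x)
    (hg0 : ∀ x, 0 ≤ g x) (hf : Integrable f μ) (hg : Integrable g μ) :
    ∫ x, √(f x) * √(g x) ∂μ ≤ √((∫ x, f x ∂μ) * ∫ x, g x ∂μ) := by
  have hL : ∀ h : ℝ → ℝ, (∀ x, 0 ≤ h x) → Integrable h μ →
      MemLp (fun x => √(h x)) (ENNReal.ofReal 2) μ := by
    intro h h0 hh
    rw [ENNReal.ofReal_ofNat, memLp_two_iff_integrable_sq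
      (Real.continuous_sqrt.comp_aestronglyMeasurable hh.aestronglyMeasurable)]
    simpa only [Real.sq_sqrt (h0 _)] using hh
  have := integral_mul_le_Lp_mul_Lq_of_nonneg (μ := μ) Real.HolderConjugate.two_two
    (f := fun x => √(f x)) (g := fun x => √(g x))
    (ae_of_all _ fun x => Real.sqrt_nonneg _) (ae_of_all _ fun x => Real.sqrt_nonneg _)
    (hL f hf0 hf) (hL g hg0 hg)
  simp only [Real.rpow_two, Real.sq_sqrt (hf0 _), Real.sq_sqrt (hg0 _)] at this
  rwa [Real.sqrt_mul (integral_nonneg hf0), Real.sqrt_eq_rpow, Real.sqrt_eq_rpow]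

open ProbabilityTheory in
lemma gaussianReal_real_apply (s : Set ℝ) :
    (gaussianReal 0 1).real s = ∫ x in s, gaussianPDFReal 0 1 x := by
  rw [Measure.real, gaussianReal_apply_eq_integral _ one_ne_zero, ENNReal.toReal_ofReal]
  exact integral_nonneg fun x => gaussianPDFReal_nonneg _ _ _

open ProbabilityTheory in
/-- The affinity of a bin under `N(0,1)` and `N(c,1)` dominates its mass under `N(c/2,1)`. -/
lemma gaussian_bin_affinity (a b c : ℝ) :
    Real.exp (-c ^ 2 / 8) * (gaussianReal 0 1).real (Set.Ico (a - c / 2) (b - c / 2)) ≤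
      √((gaussianReal 0 1).real (Set.Ico a b) *
        (gaussianReal 0 1).real (Set.Ico (a - c) (b - c))) := by
  have shift : ∀ d : ℝ, (gaussianReal 0 1).real (Set.Ico (a - d) (b - d)) =
      ∫ x in Set.Ico a b, gaussianPDFReal 0 1 (x - d) := by
    intro d
    rw [gaussianReal_real_apply, ← integral_indicator measurableSet_Ico,
      ← integral_indicator measurableSet_Ico, ← integral_sub_right_eq_self _ d]
    refine integral_congr_ae (ae_of_all _ fun x => ?_)
    simp [Set.indicator_apply]
  have hpdf := integrable_gaussianPDFReal 0 1
  have h := integral_mul_le_sqrt_mul_sqrt (μ := volume.restrict (Set.Ico a b))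
    (f := gaussianPDFReal 0 1) (g := fun x => gaussianPDFReal 0 1 (x - c))
    (gaussianPDFReal_nonneg _ _) (fun x => gaussianPDFReal_nonneg _ _ _)
    hpdf.integrableOn (hpdf.comp_sub_right c).integrableOn
  rw [shift (c / 2), shift c, gaussianReal_real_apply, ← integral_const_mul]
  refine le_trans (le_of_eq ?_) h
  refine integral_congr_ae (ae_of_all _ fun x => ?_)
  simp only [gaussianPDFReal]
  have hk : (0 : ℝ) ≤ (√(2 * Real.pi * (1 : NNReal)))⁻¹ := by positivity
  rw [Real.sqrt_mul hk, Real.sqrt_mul hk, ← Real.exp_half, ← Real.exp_half,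
    mul_mul_mul_comm, Real.mul_self_sqrt hk, ← Real.exp_add, mul_left_comm, ← Real.exp_add]
  congr 2
  push_cast
  ring

open ProbabilityTheory in
lemma tendsto_gaussian_Ico (c : ℝ) :
    Tendsto (fun K : ℝ => (gaussianReal 0 1).real (Set.Ico (-K - c) (K - c))) atTop
      (nhds 1) := by
  have hmono : Monotone fun K : ℝ => Set.Ico (-K - c) (K - c) := fun K K' h =>
    Set.Ico_subset_Ico (by linarith) (by linarith)
  have hU : ⋃ K : ℝ, Set.Ico (-K - c) (K - c) = Set.univ := by
    refine Set.eq_univ_of_forall fun x => Set.mem_iUnion.2 ⟨|x + c| + 1, ?_⟩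
    constructor <;> linarith [neg_abs_le (x + c), le_abs_self (x + c)]
  have := tendsto_measure_iUnion_atTop (μ := gaussianReal 0 1) hmono
  rw [hU, measure_univ] at this
  exact ENNReal.toReal_one ▸ (ENNReal.tendsto_toReal ENNReal.one_ne_top).comp this

lemma sqrt_mul_zscore [Fintype α] {P : α → ℝ} (hV : 0 < V P) (n : ℕ) (f : Fin n → α) :
    √n * √(V P) * zscore P n f = -(∑ i, Real.log (P (f i))) - n * H P := by
  have hs := Real.sqrt_pos.2 hV
  have e : ∑ i, (-Real.log (P (f i)) - H P) / √(V P) =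
      (-(∑ i, Real.log (P (f i))) - n * H P) / √(V P) := by
    rw [← Finset.sum_div, Finset.sum_sub_distrib, Finset.sum_neg_distrib]; simp
  rw [zscore, e]
  rcases Nat.eq_zero_or_pos n with rfl | hn
  · simp
  · have : 0 < √(n : ℝ) := Real.sqrt_pos.2 (by exact_mod_cast hn)
    field_simp

lemma iid_le_exp_zscore [Fintype α] {P : α → ℝ} (hP : IsProb P) (hV : 0 < V P) (n : ℕ)
    (f : Fin n → α) :
    iid P n f ≤ Real.exp (-(n * H P + √n * √(V P) * zscore P n f)) := by
  rw [sqrt_mul_zscore hV, iid]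
  have : -(n * H P + (-(∑ i, Real.log (P (f i))) - n * H P)) = ∑ i, Real.log (P (f i)) := by ring
  rw [this, Real.exp_sum]
  exact Finset.prod_le_prod (fun i _ => hP.1 _) fun i _ => Real.le_exp_log _

lemma iid_eq_exp_zscore [Fintype α] {P : α → ℝ} (hP : IsProb P) (hV : 0 < V P) (n : ℕ)
    (f : Fin n → α) (hf : iid P n f ≠ 0) :
    iid P n f = Real.exp (-(n * H P + √n * √(V P) * zscore P n f)) := by
  rw [sqrt_mul_zscore hV, iid]
  have : -(n * H P + (-(∑ i, Real.log (P (f i))) - n * H P)) = ∑ i, Real.log (P (f i)) := by ring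
  rw [this, Real.exp_sum]
  refine Finset.prod_congr rfl fun i hi => (Real.exp_log ?_).symm
  exact (hP.1 _).lt_of_ne' (Finset.prod_ne_zero_iff.1 hf i hi)

lemma sum_measureReal_Ico {μ : Measure ℝ} [IsFiniteMeasure μ] {u : ℕ → ℝ} (hu : Monotone u)
    (N : ℕ) :
    ∑ i ∈ Finset.range N, μ.real (Set.Ico (u i) (u (i + 1))) = μ.real (Set.Ico (u 0) (u N)) := by
  induction N with
  | zero => simp
  | succ N ih =>
    rw [Finset.sum_range_succ, ih, ← measureReal_union _ measurableSet_Ico,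
      Set.Ico_union_Ico_eq_Ico (hu N.zero_le) (hu N.le_succ)]
    exact Set.Ico_disjoint_Ico_same

open Classical in
lemma disjoint_filter_Ico [Fintype α] (Z : α → ℝ) {v : ℕ → ℝ} (hv : Monotone v) {i j : ℕ}
    (hij : i ≠ j) :
    Disjoint (Finset.univ.filter fun f => Z f ∈ Set.Ico (v i) (v (i + 1)))
      (Finset.univ.filter fun f => Z f ∈ Set.Ico (v j) (v (j + 1))) :=
  Finset.disjoint_filter.2 fun _ _ h1 h2 =>
    Set.disjoint_left.1 (hv.pairwise_disjoint_on_Ico_succ hij) h1 h2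

/-- Bins of standardized surprisal give an explicit lower bound on the optimal fidelity. -/
lemma sum_sqrt_law_le_FD [Fintype α] [Fintype β] {P : α → ℝ} {Q : β → ℝ} (hP : IsProb P)
    (hQ : IsProb Q) (hVP : 0 < V P) (hVQ : 0 < V Q) {u : ℕ → ℝ} (hu : Monotone u) (c : ℝ)
    (N n L : ℕ) :
    ∑ i ∈ Finset.range N,
      (√((law (iid P n) (zscore P n)).real (Set.Ico (u i) (u (i + 1))) *
          (law (iid Q L) (zscore Q L)).real (Set.Ico (u i - c) (u (i + 1) - c))) -
        √(Real.exp (L * H Q + √L * √(V Q) * (u (i + 1) - c) -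
            (n * H P + √n * √(V P) * u i)))) ≤ FD (iid P n) (iid Q L) := by
  classical
  have hsqP : 0 ≤ √(n : ℝ) * √(V P) := by positivity
  have hsqQ : 0 ≤ √(L : ℝ) * √(V Q) := by positivity
  refine le_trans (le_of_eq ?_) (sum_sqrt_le_FD (Finset.range N) (isProb_iid hP n)
    (isProb_iid hQ L)
    (fun i => Finset.univ.filter fun f => zscore P n f ∈ Set.Ico (u i) (u (i + 1)))
    (fun i => (Finset.univ.filter fun f => zscore Q L f ∈
      Set.Ico (u i - c) (u (i + 1) - c)).filter fun f => iid Q L f ≠ 0)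
    (fun i _ j _ hij => disjoint_filter_Ico (zscore P n) hu hij)
    (fun i _ j _ hij => (disjoint_filter_Ico (zscore Q L) (v := fun i => u i - c)
      (fun i j h => sub_le_sub_right (hu h) c) hij).mono
      (Finset.filter_subset _ _) (Finset.filter_subset _ _))
    (c := fun i => Real.exp (-(n * H P + √n * √(V P) * u i)))
    (d := fun i => Real.exp (-(L * H Q + √L * √(V Q) * (u (i + 1) - c))))
    (fun i _ => (Real.exp_pos _).le) (fun i _ => Real.exp_pos _) ?_ ?_)
  · refine Finset.sum_congr rfl fun i _ => ?_
    rw [law_real_apply (isProb_iid hP n) _ measurableSet_Ico,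
      law_real_apply (isProb_iid hQ L) _ measurableSet_Ico, Finset.sum_filter_ne_zero,
      ← Real.exp_sub]
    congr 3
    · exact Finset.sum_congr (by ext; simp) fun _ _ => rfl
    · exact Finset.sum_congr (by ext; simp) fun _ _ => rfl
    · ring
  · intro i _ f hf
    refine (iid_le_exp_zscore hP hVP n f).trans (Real.exp_le_exp.2 ?_)
    have := mul_le_mul_of_nonneg_left (Finset.mem_filter.1 hf).2.1 hsqP
    linarith
  · intro i _ f hf
    rw [Finset.mem_filter, Finset.mem_filter] at hf
    rw [iid_eq_exp_zscore hQ hVQ L f hf.2]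
    refine Real.exp_le_exp.2 ?_
    have := mul_le_mul_of_nonneg_left hf.1.2.2.le hsqQ
    linarith

lemma eventually_lt_FD [Fintype α] [Fintype β] {P : α → ℝ} {Q : β → ℝ} (hP : IsProb P)
    (hQ : IsProb Q) (hVP : 0 < V P) (hVQ : 0 < V Q) (hratio : H P / V P = H Q / V Q)
    {L : ℕ → ℕ} {b : ℝ}
    (hL : Tendsto (fun n : ℕ => ((L n : ℝ) - H P / H Q * n) / √n) atTop (nhds b))
    {c : ℝ} (hc : c < Real.exp (-(H Q * b) ^ 2 / (8 * V P))) :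
    ∀ᶠ n : ℕ in atTop, c < FD (iid P n) (iid Q (L n)) := by
  have hHQ := H_pos hQ hVQ
  have hHP := H_pos hP hVP
  set r := H P / H Q with hr
  have hr0 : 0 < r := by positivity
  have hrV : r * V Q = V P := by
    rw [div_eq_div_iff hVP.ne' hVQ.ne'] at hratio
    rw [hr]; field_simp; linarith
  set σ := √(V P) with hσ
  have hσ0 : 0 < σ := Real.sqrt_pos.2 hVP
  set c₀ := H Q * b / σ with hc₀
  have hc₀b : σ * c₀ = b * H Q := by rw [hc₀]; field_simp
  have hexp0 : -(H Q * b) ^ 2 / (8 * V P) = -c₀ ^ 2 / 8 := by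
    rw [hc₀, div_pow, hσ, Real.sq_sqrt hVP.le]; field_simp
  rw [hexp0] at hc
  obtain ⟨c₁, hc₁, hcc⟩ : ∃ c₁, c < Real.exp (-c₁ ^ 2 / 8) ∧ c₀ < c₁ := by
    have hcont : Continuous fun x : ℝ => Real.exp (-x ^ 2 / 8) := by fun_prop
    have h1 := (hcont.tendsto c₀).eventually_const_lt hc
    have h2 : ∀ᶠ x in nhdsWithin c₀ (Set.Ioi c₀), c < Real.exp (-x ^ 2 / 8) ∧ c₀ < x :=
      (h1.filter_mono nhdsWithin_le_nhds).and self_mem_nhdsWithin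
    exact h2.exists
  obtain ⟨K, hK, hK0⟩ : ∃ K : ℝ, c < Real.exp (-c₁ ^ 2 / 8) *
      (ProbabilityTheory.gaussianReal 0 1).real (Set.Ico (-K - c₁ / 2) (K - c₁ / 2)) ∧ 0 < K := by
    have h1 := (tendsto_gaussian_Ico (c₁ / 2)).const_mul (Real.exp (-c₁ ^ 2 / 8))
    rw [mul_one] at h1
    exact ((h1.eventually_const_lt hc₁).and (eventually_gt_atTop 0)).exists
  obtain ⟨N, hN⟩ := exists_nat_gt (2 * K / (c₁ - c₀))
  have hcc' : 0 < c₁ - c₀ := sub_pos.2 hcc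
  have hN0 : (0 : ℝ) < N := lt_of_le_of_lt (by positivity) hN
  set δ := 2 * K / N with hδ
  have hδ0 : 0 < δ := by positivity
  have hδc : δ < c₁ - c₀ := by
    rw [div_lt_iff₀ hcc'] at hN
    rw [hδ, div_lt_iff₀ hN0]; linarith
  set u : ℕ → ℝ := fun i => -K + i * δ with hudef
  have hu : Monotone u := fun i j hij => by
    have : (i : ℝ) ≤ j := by exact_mod_cast hij
    simp only [hudef]; nlinarith
  have hLtop : Tendsto L atTop atTop := by
    rw [← tendsto_natCast_atTop_iff (R := ℝ)]
    refine ((tendsto_div_of_second_order hL).pos_mul_atTop hr0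
      (tendsto_natCast_atTop_atTop (R := ℝ))).congr' ?_
    filter_upwards [eventually_gt_atTop 0] with n hn
    have : (n : ℝ) ≠ 0 := by exact_mod_cast hn.ne'
    field_simp
  have hgap : ∀ i : ℕ, Tendsto (fun n : ℕ =>
      √(Real.exp (L n * H Q + √(L n : ℝ) * √(V Q) * (u (i + 1) - c₁) -
            (n * H P + √(n : ℝ) * √(V P) * u i)))) atTop (nhds 0) := by
    intro i
    have hbr : Tendsto (fun n : ℕ => ((L n : ℝ) - r * n) / √n * H Q +
        √((L n : ℝ) / n) * √(V Q) * (u (i + 1) - c₁) - σ * u i) atTop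
        (nhds (b * H Q + √r * √(V Q) * (u (i + 1) - c₁) - σ * u i)) :=
      ((hL.mul_const _).add ((((Real.continuous_sqrt.tendsto r).comp
        (tendsto_div_of_second_order hL)).mul_const _).mul_const _)).sub_const _
    have hneg : b * H Q + √r * √(V Q) * (u (i + 1) - c₁) - σ * u i < 0 := by
      have hst : u (i + 1) = u i + δ := by simp only [hudef]; push_cast; ring
      rw [← Real.sqrt_mul hr0.le, hrV, ← hσ, ← hc₀b, hst]
      nlinarith [mul_pos hσ0 (sub_pos.2 hδc)]
    have hbot := tendsto_sqrt_natCast.atTop_mul_neg hneg hbr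
    have := (Real.continuous_sqrt.tendsto 0).comp (Real.tendsto_exp_atBot.comp hbot)
    rw [Real.sqrt_zero] at this
    refine this.congr' ?_
    filter_upwards [eventually_gt_atTop 0] with n hn
    have hn' : (0 : ℝ) < n := by exact_mod_cast hn
    have hsq := Real.sqrt_pos.2 hn'
    have hsq2 := Real.sq_sqrt hn'.le
    simp only [Function.comp]
    congr 2
    rw [Real.sqrt_div (Nat.cast_nonneg _)]
    have hrH : r * H Q = H P := by rw [hr]; field_simp
    field_simp
    linear_combination (-(n : ℝ)) * hrH
  have hlim : Tendsto (fun n : ℕ => ∑ i ∈ Finset.range N,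
      (√((law (iid P n) (zscore P n)).real (Set.Ico (u i) (u (i + 1))) *
          (law (iid Q (L n)) (zscore Q (L n))).real (Set.Ico (u i - c₁) (u (i + 1) - c₁))) -
        √(Real.exp (L n * H Q + √(L n : ℝ) * √(V Q) * (u (i + 1) - c₁) -
            (n * H P + √(n : ℝ) * √(V P) * u i))))) atTop
      (nhds (∑ i ∈ Finset.range N,
        (√((ProbabilityTheory.gaussianReal 0 1).real (Set.Ico (u i) (u (i + 1))) *
          (ProbabilityTheory.gaussianReal 0 1).real
            (Set.Ico (u i - c₁) (u (i + 1) - c₁))) - 0))) :=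
    tendsto_finsetSum _ fun i _ => ((Real.continuous_sqrt.tendsto _).comp
      ((tendsto_law_zscore hP hVP _ _).mul ((tendsto_law_zscore hQ hVQ _ _).comp hLtop))).sub
        (hgap i)
  have hval : c < ∑ i ∈ Finset.range N,
      (√((ProbabilityTheory.gaussianReal 0 1).real (Set.Ico (u i) (u (i + 1))) *
        (ProbabilityTheory.gaussianReal 0 1).real
          (Set.Ico (u i - c₁) (u (i + 1) - c₁))) - 0) := by
    have hsum := sum_measureReal_Ico (μ := ProbabilityTheory.gaussianReal 0 1)
      (u := fun i => u i - c₁ / 2) (fun i j h => sub_le_sub_right (hu h) _) N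
    have hu0 : u 0 = -K := by simp [hudef]
    have huN : u N = K := by simp only [hudef, hδ]; field_simp; ring
    simp only [hu0, huN] at hsum
    rw [← hsum, Finset.mul_sum] at hK
    refine hK.trans_le (Finset.sum_le_sum fun i _ => ?_)
    rw [sub_zero]
    exact gaussian_bin_affinity _ _ _
  filter_upwards [hlim.eventually_const_lt hval] with n hn
  exact hn.trans_le (sum_sqrt_law_le_FD hP hQ hVP hVQ hu c₁ N n (L n))

lemma tendsto_floor_second_order {r b : ℝ} (hr : 0 ≤ r) (hb : 0 ≤ b) :
    Tendsto (fun n : ℕ => ((⌊r * n + b * √(n : ℝ)⌋₊ : ℝ) - r * n) / √n) atTop (nhds b) := by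
  have hlow : Tendsto (fun n : ℕ => b - (√(n : ℝ))⁻¹) atTop (nhds b) := by
    simpa using (tendsto_inv_atTop_zero.comp tendsto_sqrt_natCast).const_sub b
  refine tendsto_of_tendsto_of_tendsto_of_le_of_le' hlow tendsto_const_nhds ?_ ?_
  all_goals
    filter_upwards [eventually_gt_atTop 0] with n hn
    have hsq : 0 < √(n : ℝ) := Real.sqrt_pos.2 (by exact_mod_cast hn)
  · rw [le_div_iff₀ hsq, sub_mul, inv_mul_cancel₀ hsq.ne']
    linarith [Nat.lt_floor_add_one (r * n + b * √(n : ℝ))]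
  · rw [div_le_iff₀ hsq]
    linarith [Nat.floor_le (show 0 ≤ r * n + b * √(n : ℝ) by positivity)]

lemma tendsto_FD [Fintype α] [Fintype β] {P : α → ℝ} {Q : β → ℝ} (hP : IsProb P)
    (hQ : IsProb Q) (hVP : 0 < V P) (hVQ : 0 < V Q) (hratio : H P / V P = H Q / V Q)
    {b : ℝ} (hb : 0 < b) :
    Tendsto (fun n : ℕ => FD (iid P n) (iid Q ⌊H P / H Q * n + b * √(n : ℝ)⌋₊)) atTop
      (nhds (Real.exp (-(H Q * b) ^ 2 / (8 * V P)))) := by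
  have hL := tendsto_floor_second_order (div_pos (H_pos hP hVP) (H_pos hQ hVQ)).le hb.le
  refine tendsto_order.2 ⟨fun c hc => eventually_lt_FD hP hQ hVP hVQ hratio hL hc, fun c hc => ?_⟩
  filter_upwards [eventually_FD_lt hP hQ hVP hVQ hratio hb hL hc] with n hn using hn _ le_rfl

lemma exp_neg_sq_lt {h v b b' : ℝ} (hh : 0 < h) (hv : 0 < v) (hb : 0 ≤ b) (hbb : b < b') :
    Real.exp (-(h * b') ^ 2 / (8 * v)) < Real.exp (-(h * b) ^ 2 / (8 * v)) := by
  refine Real.exp_lt_exp.2 (div_lt_div_of_pos_right (neg_lt_neg ?_) (by positivity))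
  exact pow_lt_pow_left₀ (mul_lt_mul_of_pos_left hbb hh) (by positivity) two_ne_zero

lemma exp_neg_sq_eq_iff {h v ν b : ℝ} (hh : 0 < h) (hv : 0 < v) (hν : 0 < ν) (hb : 0 < b) :
    Real.exp (-(h * b) ^ 2 / (8 * v)) = ν ↔ b = √(8 * v * Real.log ν⁻¹) / h := by
  have hexp : ∀ x, Real.exp x = ν ↔ x = Real.log ν := fun x =>
    ⟨fun e => by rw [← e, Real.log_exp], fun e => by rw [e, Real.exp_log hν]⟩
  rw [hexp, eq_div_iff hh.ne', eq_comm (a := b * h),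
    Real.sqrt_eq_iff_mul_self_eq_of_pos (by positivity), Real.log_inv,
    div_eq_iff (by positivity : 8 * v ≠ 0)]
  constructor <;> intro e <;> linarith

/-- second order expansion of `L^D_n(P,Q|ν)` when
`H(P)/V(P) = H(Q)/V(Q)`. -/
theorem second_order_rate_case_eq {X Y : Type*} [Fintype X] [Fintype Y]
    (P : X → ℝ) (Q : Y → ℝ) (hP : IsProb P) (hQ : IsProb Q)
    (hVP : 0 < V P) (hVQ : 0 < V Q)
    (hratio : H P / V P = H Q / V Q)
    (ν : ℝ) (hν : 0 < ν ∧ ν < 1) :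
    Tendsto (fun n : ℕ =>
        ((LD P Q ν n : ℝ) - H P / H Q * n) / Real.sqrt n) atTop
      (nhds (Real.sqrt (8 * V P * Real.log ν⁻¹) / H Q)) ∧
    RD2 P Q ν = Real.sqrt (8 * V P * Real.log ν⁻¹) / H Q ∧
    ∀ b : ℝ, 0 < b →
      (Real.exp (-(H Q * b) ^ 2 / (8 * V P)) = ν ↔
        b = Real.sqrt (8 * V P * Real.log ν⁻¹) / H Q) := by
  obtain ⟨hν0, hν1⟩ := hν
  have hHP := H_pos hP hVP
  have hHQ := H_pos hQ hVQ
  have hr := div_pos hHP hHQ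
  have hlog : 0 < Real.log ν⁻¹ := Real.log_pos ((one_lt_inv₀ hν0).2 hν1)
  set b₀ := √(8 * V P * Real.log ν⁻¹) / H Q with hb₀
  have hb₀pos : 0 < b₀ := by positivity
  have hb₀ν : Real.exp (-(H Q * b₀) ^ 2 / (8 * V P)) = ν :=
    (exp_neg_sq_eq_iff hHQ hVP hν0 hb₀pos).2 rfl
  refine ⟨tendsto_order.2 ⟨fun a ha => ?_, fun a ha => ?_⟩, IsGreatest.csSup_eq ⟨?_, ?_⟩,
    fun b hb => exp_neg_sq_eq_iff hHQ hVP hν0 hb⟩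
  · obtain ⟨b₁, hb₁, hb₁₀⟩ := exists_between (max_lt ha hb₀pos)
    have hb₁pos : 0 < b₁ := (le_max_right _ _).trans_lt hb₁
    have hL₁ := tendsto_floor_second_order hr.le hb₁pos.le
    have hL₂ := tendsto_floor_second_order hr.le (hb₀pos.trans (lt_add_one b₀)).le
    have hge := eventually_lt_FD hP hQ hVP hVQ hratio hL₁
      (hb₀ν ▸ exp_neg_sq_lt hHQ hVP hb₁pos.le hb₁₀)
    have hlt := eventually_FD_lt hP hQ hVP hVQ hratio (hb₀pos.trans (lt_add_one b₀)) hL₂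
      (hb₀ν ▸ exp_neg_sq_lt hHQ hVP hb₀pos.le (lt_add_one b₀))
    filter_upwards [hge, hlt, hL₁.eventually_const_lt ((le_max_left _ _).trans_lt hb₁)]
      with n h₁ h₂ h₃
    refine h₃.trans_le (div_le_div_of_nonneg_right (sub_le_sub_right ?_ _) (Real.sqrt_nonneg _))
    refine Nat.cast_le.2
      (le_csSup ⟨⌊H P / H Q * n + (b₀ + 1) * √(n : ℝ)⌋₊, fun L hL => ?_⟩ h₁.le)
    exact le_of_lt (not_le.1 fun h => (h₂ L h).not_ge hL)
  · obtain ⟨b₂, hb₂₀, hb₂⟩ := exists_between ha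
    have hb₂pos := hb₀pos.trans hb₂₀
    have hL₂ := tendsto_floor_second_order hr.le hb₂pos.le
    have hlt := eventually_FD_lt hP hQ hVP hVQ hratio hb₂pos hL₂
      (hb₀ν ▸ exp_neg_sq_lt hHQ hVP hb₀pos.le hb₂₀)
    filter_upwards [hlt, hL₂.eventually_lt_const hb₂] with n h₂ h₃
    refine lt_of_le_of_lt (div_le_div_of_nonneg_right (sub_le_sub_right ?_ _)
      (Real.sqrt_nonneg _)) h₃
    refine Nat.cast_le.2 (csSup_le' fun L hL => ?_)
    exact le_of_lt (not_le.1 fun h => (h₂ L h).not_ge hL)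
  · exact ⟨ν, le_rfl, by simpa only [hb₀ν] using tendsto_FD hP hQ hVP hVQ hratio hb₀pos⟩
  · rintro b ⟨c, hνc, hc⟩
    by_contra! hlt
    have hlim := tendsto_FD hP hQ hVP hVQ hratio (hb₀pos.trans hlt)
    rw [tendsto_nhds_unique hc hlim] at hνc
    exact (hb₀ν ▸ exp_neg_sq_lt hHQ hVP hb₀pos.le hlt).not_ge hνc

end RNG
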